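/- arXiv:1207.6182 — 2 statements merged into one kernel-verified Lean document; each statement's English description precedes it below -/
import Mathlib

section
/- Let B⁵₂₆ be the pure 5-dimensional simplicial complex on the 26-element vertex set V₂₆ = {a_i, b_i : i ∈ Z₁₃} whose 91 facets are the images under the Z₁₃-action (j·a_k = a_{j+k}, j·b_k = b_{j+k}, indices mod 13) of the seven facets a₀a₁₀a₁₁a₁₂b₉b₁₀, a₀a₁a₁₀a₁₁a₁₂b₁₀, a₀a₁₁a₁₂b₅b₉b₁₀, a₀a₁₁a₁₂b₂b₅b₁₀, a₀a₇a₁₂b₂b₅b₁₀, a₇a₁₂b₀b₂b₅b₁₀, a₇b₀b₂b₅b₈b₁₀. Then B⁵₂₆ is 2-neighborly and every vertex link of B⁵₂₆ is a stacked 4-ball (i.e., B⁵₂₆ is a neighborly member of K̄(5)). -/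
variable {V : Type*} [DecidableEq V]

/-- The number of faces of the complex with facet set `F` having exactly `k` vertices
(i.e. of dimension `k - 1`). -/
def faceCount (F : Finset (Finset V)) (k : ℕ) : ℕ :=
  (F.biUnion fun σ => σ.powersetCard k).card

/-- The vertex set of the complex with facet set `F`. -/
def vertexSet (F : Finset (Finset V)) : Finset V := F.biUnion id

/-- The dual graph of a pure `d`-dimensional complex given by its facet set `F`:
two facets are adjacent iff their intersection has `d` vertices (dimension `d-1`). -/
def dualGraph (d : ℕ) (F : Finset (Finset V)) : SimpleGraph {σ // σ ∈ F} where
  Adj σ τ := σ ≠ τ ∧ (σ.1 ∩ τ.1).card = d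
  symm := ⟨fun σ τ h => ⟨h.1.symm, by rw [Finset.inter_comm]; exact h.2⟩⟩
  loopless := ⟨fun σ h => h.1 rfl⟩

/-- `IsStackedBall d F` : the pure `d`-dimensional complex with facet set `F` is a
stacked `d`-ball, i.e. it is obtained from a single `d`-simplex by repeatedly gluing
a new `d`-simplex `σ` along a single `(d-1)`-face `τ` lying in exactly one facet of the previous complex
(so that the intersection of the old complex with the new simplex is exactly `τ̄`). -/
inductive IsStackedBall : ℕ → Finset (Finset V) → Prop
  | single (d : ℕ) (σ : Finset V) (h : σ.card = d + 1) : IsStackedBall d {σ}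
  | glue (d : ℕ) (F : Finset (Finset V)) (σ τ : Finset V) :
      IsStackedBall d F → σ.card = d + 1 → σ ∉ F → τ ⊆ σ → τ.card = d →
      (∃! ρ, ρ ∈ F ∧ τ ⊆ ρ) → (∀ ρ ∈ F, ρ ∩ σ ⊆ τ) → IsStackedBall d (insert σ F)

/-- The facet set of the link of the vertex `x` in the pure complex with facet set `F`. -/
def linkFacets (F : Finset (Finset V)) (x : V) : Finset (Finset V) :=
  (F.filter fun σ => x ∈ σ).image fun σ => σ.erase x

/-- The facet set of the boundary of a pure `d`-dimensional weak pseudomanifold with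
facet set `F` : the `d`-element subsets of facets lying in exactly one facet. -/
def bdryFacets (d : ℕ) (F : Finset (Finset V)) : Finset (Finset V) :=
  (F.biUnion fun σ => σ.powersetCard d).filter fun τ => (F.filter fun σ => τ ⊆ σ).card = 1

/-- A complex (given by its facet set `S`) is a stacked `d`-sphere if it is the boundary
of a stacked `(d+1)`-ball. -/
def IsStackedSphere (d : ℕ) (S : Finset (Finset V)) : Prop :=
  ∃ B : Finset (Finset V), IsStackedBall (d + 1) B ∧ S = bdryFacets (d + 1) B

/-- The vertices `a_i`, `b_i`, `i ∈ Z₁₃`, of `V₂₆`. -/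
def a (i : ZMod 13) : Fin 2 × ZMod 13 := (0, i)
def b (i : ZMod 13) : Fin 2 × ZMod 13 := (1, i)

/-- The `Z₁₃`-action `j ⬝ a_k = a_{j+k}`, `j ⬝ b_k = b_{j+k}`. -/
def shift13 (j : ZMod 13) (σ : Finset (Fin 2 × ZMod 13)) : Finset (Fin 2 × ZMod 13) :=
  σ.image fun p => (p.1, p.2 + j)

/-- The seven basic facets of `B⁵₂₆`. -/
def baseB26 : Finset (Finset (Fin 2 × ZMod 13)) :=
  { {a 0, a 10, a 11, a 12, b 9, b 10}, {a 0, a 1, a 10, a 11, a 12, b 10},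
    {a 0, a 11, a 12, b 5, b 9, b 10}, {a 0, a 11, a 12, b 2, b 5, b 10},
    {a 0, a 7, a 12, b 2, b 5, b 10}, {a 7, a 12, b 0, b 2, b 5, b 10},
    {a 7, b 0, b 2, b 5, b 8, b 10} }

/-- The facet set of `B⁵₂₆` : all `Z₁₃`-images of the seven basic facets. -/
def B26 : Finset (Finset (Fin 2 × ZMod 13)) :=
  (Finset.univ : Finset (ZMod 13)).biUnion fun j => baseB26.image (shift13 j)

def link_a : List (Finset (Fin 2 × ZMod 13)) :=
  [{a 5, a 6, b 3, b 8, b 11},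
   {a 5, b 3, b 6, b 8, b 11},
   {b 1, b 3, b 6, b 8, b 11},
   {a 7, a 12, b 2, b 5, b 10},
   {a 11, a 12, b 2, b 5, b 10},
   {a 11, a 12, b 5, b 9, b 10},
   {a 9, a 10, a 11, a 12, b 9},
   {a 10, a 11, a 12, b 9, b 10},
   {a 8, b 1, b 3, b 6, b 11},
   {a 1, a 8, b 3, b 6, b 11},
   {a 1, a 12, b 3, b 6, b 11},
   {a 1, a 12, b 6, b 10, b 11},
   {a 1, a 10, a 11, a 12, b 10},
   {a 1, a 11, a 12, b 10, b 11},
   {a 1, a 2, b 4, b 7, b 12},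
   {a 1, a 2, b 7, b 11, b 12},
   {a 1, a 2, a 11, a 12, b 11},
   {a 1, a 2, a 12, b 11, b 12},
   {a 1, a 2, a 3, a 12, b 12},
   {a 1, a 2, a 3, b 0, b 12},
   {a 1, a 2, a 3, a 4, b 0}]
def link_b : List (Finset (Fin 2 × ZMod 13)) :=
  [{a 12, b 2, b 5, b 7, b 10},
   {a 9, a 10, a 11, b 3, b 8},
   {a 5, b 3, b 6, b 8, b 11},
   {a 5, a 10, a 11, b 3, b 8},
   {a 5, a 10, b 3, b 8, b 11},
   {a 10, b 3, b 5, b 8, b 11},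
   {a 7, a 12, b 2, b 5, b 10},
   {a 7, b 2, b 5, b 8, b 10},
   {a 6, a 7, a 8, b 4, b 5},
   {a 6, a 7, a 8, b 5, b 10},
   {a 2, a 7, a 8, b 5, b 10},
   {a 2, a 7, b 5, b 8, b 10},
   {a 2, b 3, b 5, b 8, b 10},
   {a 2, a 10, b 3, b 5, b 8},
   {a 2, a 3, a 10, b 5, b 8},
   {a 2, a 3, a 4, b 1, b 9},
   {a 1, a 2, a 3, b 5, b 8},
   {a 1, a 2, a 3, b 8, b 12},
   {a 1, a 2, a 3, a 4, b 1},
   {a 0, a 1, a 2, a 3, b 12},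
   {a 0, a 1, a 2, a 3, a 4}]

def stackChk : List (Finset (Fin 2 × ZMod 13)) → Bool
  | [] => false
  | [σ] => decide (σ.card = 5)
  | σ :: l => stackChk l && decide (σ.card = 5) && decide (σ ∉ l) &&
      l.any fun ρ => decide ((σ ∩ ρ).card = 4) &&
        l.all fun π => decide (σ ∩ ρ ⊆ π → π = ρ) && decide (π ∩ σ ⊆ σ ∩ ρ)

theorem stackChk_sound (l : List (Finset (Fin 2 × ZMod 13))) (h : stackChk l = true) :
    IsStackedBall 4 l.toFinset := by
  fun_induction stackChk l with
  | case1 => simp at h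
  | case2 σ => simpa using IsStackedBall.single 4 σ (by simpa using h)
  | case3 σ l _ ih =>
    simp only [Bool.and_eq_true, decide_eq_true_eq, List.any_eq_true, List.all_eq_true] at h
    obtain ⟨⟨⟨h1, h2⟩, h3⟩, ρ, hρ, h4, h5⟩ := h
    rw [List.toFinset_cons]
    refine IsStackedBall.glue 4 _ σ (σ ∩ ρ) (ih h1) h2 (by simpa using h3)
      Finset.inter_subset_left h4 ⟨ρ, ⟨by simpa using hρ, Finset.inter_subset_right⟩, ?_⟩ ?_
    · rintro π ⟨hπ, h6⟩
      exact (h5 π (by simpa using hπ)).1 h6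
    · intro π hπ
      exact (h5 π (by simpa using hπ)).2

theorem shiftFun_inj (j : ZMod 13) :
    Function.Injective (fun p : Fin 2 × ZMod 13 => (p.1, p.2 + j)) := by
  rintro ⟨x, y⟩ ⟨z, w⟩ h
  simpa using h

theorem shift13_inj (j : ZMod 13) : Function.Injective (shift13 j) :=
  Finset.image_injective (shiftFun_inj j)

theorem shift13_card (j : ZMod 13) (σ : Finset (Fin 2 × ZMod 13)) :
    (shift13 j σ).card = σ.card := Finset.card_image_of_injective _ (shiftFun_inj j)

theorem shift13_subset (j : ZMod 13) (σ τ : Finset (Fin 2 × ZMod 13)) :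
    shift13 j σ ⊆ shift13 j τ ↔ σ ⊆ τ := Finset.image_subset_image_iff (shiftFun_inj j)

theorem shift13_inter (j : ZMod 13) (σ τ : Finset (Fin 2 × ZMod 13)) :
    shift13 j (σ ∩ τ) = shift13 j σ ∩ shift13 j τ := Finset.image_inter _ _ (shiftFun_inj j)

theorem shift13_add (i j : ZMod 13) (σ : Finset (Fin 2 × ZMod 13)) :
    shift13 j (shift13 i σ) = shift13 (i + j) σ := by
  simp only [shift13, Finset.image_image]
  congr 1
  funext p
  simp [add_assoc]

theorem shift13_mem (j : ZMod 13) (c : Fin 2) (i : ZMod 13) (σ : Finset (Fin 2 × ZMod 13)) :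
    (c, i + j) ∈ shift13 j σ ↔ (c, i) ∈ σ :=
  (shiftFun_inj j).mem_finset_image (a := (c, i))

theorem shift13_erase (j : ZMod 13) (c : Fin 2) (i : ZMod 13) (σ : Finset (Fin 2 × ZMod 13)) :
    shift13 j (σ.erase (c, i)) = (shift13 j σ).erase (c, i + j) :=
  Finset.image_erase (shiftFun_inj j) σ (c, i)

theorem stacked_shift (j : ZMod 13) (d : ℕ) (F : Finset (Finset (Fin 2 × ZMod 13)))
    (h : IsStackedBall d F) : IsStackedBall d (F.image (shift13 j)) := by
  induction h with
  | single σ h =>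
    rw [Finset.image_singleton]
    exact .single d _ (by rw [shift13_card, h])
  | glue F σ τ _ h1 h2 h3 h4 h5 h6 ih =>
    rw [Finset.image_insert]
    refine .glue d _ _ (shift13 j τ) ih (by rw [shift13_card, h1]) ?_
      ((shift13_subset ..).2 h3) (by rw [shift13_card, h4]) ?_ ?_
    · rwa [(shift13_inj j).mem_finset_image]
    · obtain ⟨ρ, ⟨r1, r2⟩, r3⟩ := h5
      refine ⟨shift13 j ρ, ⟨Finset.mem_image_of_mem _ r1, (shift13_subset ..).2 r2⟩, ?_⟩
      rintro π ⟨p1, p2⟩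
      obtain ⟨π, q1, rfl⟩ := Finset.mem_image.1 p1
      rw [r3 π ⟨q1, (shift13_subset ..).1 p2⟩]
    · intro π p1
      obtain ⟨π, q1, rfl⟩ := Finset.mem_image.1 p1
      rw [← shift13_inter, shift13_subset]
      exact h6 π q1

theorem mem_B26 (σ : Finset (Fin 2 × ZMod 13)) :
    σ ∈ B26 ↔ ∃ j, ∃ τ ∈ baseB26, shift13 j τ = σ := by
  simp [B26]

theorem shift_B26 (j : ZMod 13) (σ : Finset (Fin 2 × ZMod 13)) (h : σ ∈ B26) :
    shift13 j σ ∈ B26 := by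
  obtain ⟨i, τ, hτ, rfl⟩ := (mem_B26 _).1 h
  exact (mem_B26 _).2 ⟨i + j, τ, hτ, (shift13_add i j τ).symm⟩

theorem shift13_zero (σ : Finset (Fin 2 × ZMod 13)) : shift13 0 σ = σ := by
  simp [shift13]

theorem link_shift (j : ZMod 13) (c : Fin 2) :
    linkFacets B26 (c, j) = (linkFacets B26 (c, 0)).image (shift13 j) := by
  ext σ
  simp only [linkFacets, Finset.mem_image, Finset.mem_filter]
  constructor
  · rintro ⟨τ, ⟨h1, h2⟩, rfl⟩
    have e : shift13 j (shift13 (-j) τ) = τ := by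
      rw [shift13_add, neg_add_cancel, shift13_zero]
    refine ⟨_, ⟨shift13 (-j) τ, ⟨shift_B26 _ _ h1, ?_⟩, rfl⟩, ?_⟩
    · rw [← shift13_mem j, e, zero_add]; exact h2
    · rw [shift13_erase, e, zero_add]
  · rintro ⟨_, ⟨τ, ⟨h1, h2⟩, rfl⟩, rfl⟩
    refine ⟨shift13 j τ, ⟨shift_B26 _ _ h1, ?_⟩, ?_⟩
    · have := (shift13_mem j c 0 τ).2 h2
      rwa [zero_add] at this
    · rw [shift13_erase, zero_add]

theorem neigh_aux : ∀ (c d : Fin 2) (i : ZMod 13),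
    ∃ j : ZMod 13, ∃ τ ∈ baseB26, (c, 0 + j) ∈ τ ∧ (d, i + j) ∈ τ := by
  decide +kernel

theorem neigh (x y : Fin 2 × ZMod 13) : ∃ σ ∈ B26, x ∈ σ ∧ y ∈ σ := by
  obtain ⟨c, i⟩ := x
  obtain ⟨d, k⟩ := y
  obtain ⟨j, τ, h, h1, h2⟩ := neigh_aux c d (k - i)
  refine ⟨shift13 (i - j) τ, (mem_B26 _).2 ⟨_, τ, h, rfl⟩, ?_, ?_⟩
  · rw [← shift13_mem (i - j)] at h1
    convert h1 using 2; ring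
  · rw [← shift13_mem (i - j)] at h2
    convert h2 using 2; ring

def baseL : List (Finset (Fin 2 × ZMod 13)) :=
  [ {a 0, a 10, a 11, a 12, b 9, b 10}, {a 0, a 1, a 10, a 11, a 12, b 10},
    {a 0, a 11, a 12, b 5, b 9, b 10}, {a 0, a 11, a 12, b 2, b 5, b 10},
    {a 0, a 7, a 12, b 2, b 5, b 10}, {a 7, a 12, b 0, b 2, b 5, b 10},
    {a 7, b 0, b 2, b 5, b 8, b 10} ]

theorem mem_baseL (τ : Finset (Fin 2 × ZMod 13)) : τ ∈ baseB26 ↔ τ ∈ baseL := by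
  simp only [baseB26, baseL, Finset.mem_insert, Finset.mem_singleton, List.mem_cons,
    List.not_mem_nil, or_false]

def zList : List (ZMod 13) := [0, 1, 2, 3, 4, 5, 6, 7, 8, 9, 10, 11, 12]

theorem mem_zList : ∀ j : ZMod 13, j ∈ zList := by decide

def linkChk1 (c : Fin 2) (l : List (Finset (Fin 2 × ZMod 13))) : Bool :=
  zList.all fun j => baseL.all fun τ =>
    decide ((c, -j) ∈ τ → shift13 j (τ.erase (c, -j)) ∈ l)

def linkChk2 (c : Fin 2) (l : List (Finset (Fin 2 × ZMod 13))) : Bool :=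
  l.all fun σ => zList.any fun j => baseL.any fun τ =>
    decide ((c, -j) ∈ τ) && decide (shift13 j (τ.erase (c, -j)) = σ)

theorem link_a1 : linkChk1 0 link_a = true := by decide +kernel
theorem link_a2 : linkChk2 0 link_a = true := by decide +kernel
theorem link_b1 : linkChk1 1 link_b = true := by decide +kernel
theorem link_b2 : linkChk2 1 link_b = true := by decide +kernel

theorem link_eq (c : Fin 2) (l : List (Finset (Fin 2 × ZMod 13)))
    (h1 : linkChk1 c l = true) (h2 : linkChk2 c l = true) :
    linkFacets B26 (c, 0) = l.toFinset := by
  simp only [linkChk1, linkChk2, List.all_eq_true, List.any_eq_true, decide_eq_true_eq,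
    Bool.and_eq_true] at h1 h2
  ext σ
  simp only [linkFacets, Finset.mem_image, Finset.mem_filter, List.mem_toFinset, mem_B26]
  constructor
  · rintro ⟨_, ⟨⟨j, τ, h, rfl⟩, h3⟩, rfl⟩
    have := h1 j (mem_zList j) τ ((mem_baseL _).1 h) (by rw [← shift13_mem j, neg_add_cancel]; exact h3)
    rwa [shift13_erase, neg_add_cancel] at this
  · intro h
    obtain ⟨j, _, τ, h3, h4, rfl⟩ := h2 σ h
    refine ⟨_, ⟨⟨j, τ, (mem_baseL _).2 h3, rfl⟩, ?_⟩, ?_⟩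
    · rw [← shift13_mem j, neg_add_cancel] at h4; exact h4
    · rw [shift13_erase, neg_add_cancel]

theorem link_a_eq : linkFacets B26 (0, 0) = link_a.toFinset :=
  link_eq 0 _ link_a1 link_a2
theorem link_b_eq : linkFacets B26 (1, 0) = link_b.toFinset :=
  link_eq 1 _ link_b1 link_b2
theorem link_a_chk : stackChk link_a = true := by decide +kernel
theorem link_b_chk : stackChk link_b = true := by decide +kernel
theorem base_card : ∀ σ ∈ baseB26, σ.card = 6 := by
  intro σ h
  simp only [baseB26, Finset.mem_insert, Finset.mem_singleton] at h
  rcases h with rfl | rfl | rfl | rfl | rfl | rfl | rfl <;> decide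

/-- `B⁵₂₆` is a pure 5-dimensional complex on the 26-element vertex
set `V₂₆` which is 2-neighborly and all of whose vertex links are stacked 4-balls,
i.e. it is a neighborly member of `K̄(5)`. -/
theorem stmt12 :
    (∀ σ ∈ B26, σ.card = 6) ∧
      vertexSet B26 = (Finset.univ : Finset (Fin 2 × ZMod 13)) ∧
      (∀ x y : Fin 2 × ZMod 13, ∃ σ ∈ B26, x ∈ σ ∧ y ∈ σ) ∧
      (∀ x : Fin 2 × ZMod 13, IsStackedBall 4 (linkFacets B26 x)) := by
  refine ⟨?_, ?_, neigh, ?_⟩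
  · intro σ h
    obtain ⟨j, τ, hτ, rfl⟩ := (mem_B26 _).1 h
    rw [shift13_card, base_card τ hτ]
  · ext x
    obtain ⟨σ, h, hx, _⟩ := neigh x x
    simp only [vertexSet, Finset.mem_biUnion, id, Finset.mem_univ, iff_true]
    exact ⟨σ, h, hx⟩
  · rintro ⟨c, j⟩
    rw [link_shift]
    apply stacked_shift
    fin_cases c
    · have := stackChk_sound _ link_a_chk
      rw [← link_a_eq] at this
      exact this
    · have := stackChk_sound _ link_b_chk
      rw [← link_b_eq] at this
      exact this
end

section
/- Let N⁴₂₆ = ∂B⁵₂₆ be the boundary complex of B⁵₂₆, where B⁵₂₆ is the pure 5-dimensional simplicial complex on V₂₆ = {a_i, b_i : i ∈ Z₁₃} whose 91 facets are the Z₁₃-images (indices mod 13) of a₀a₁₀a₁₁a₁₂b₉b₁₀, a₀a₁a₁₀a₁₁a₁₂b₁₀, a₀a₁₁a₁₂b₅b₉b₁₀, a₀a₁₁a₁₂b₂b₅b₁₀, a₀a₇a₁₂b₂b₅b₁₀, a₇a₁₂b₀b₂b₅b₁₀, a₇b₀b₂b₅b₈b₁₀. Then N⁴₂₆ is a 2-neighborly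 4-dimensional weak pseudomanifold on 26 vertices, every vertex link of N⁴₂₆ is a stacked 3-sphere (i.e., N⁴₂₆ ∈ K(4)), its face vector is (f₀, f₁, f₂, f₃, f₄) = (26, 325, 780, 845, 338), and its Euler characteristic is χ = −26, so that f₀(f₀ − 11) = −15χ. -/
variable {V : Type*} [DecidableEq V]

/-- The facet set of the boundary complex. -/
def N26 : Finset (Finset (Fin 2 × ZMod 13)) := bdryFacets 5 B26

def LB : List ℕ := [
  12590081, 8395779, 12851201, 8689665, 8687745, 8695936, 10788992, 25171971, 16783367, 
  25694211, 17371139, 17367299, 17383681, 21577984, 50335751, 33558543, 51380231, 34734087, 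
  34734598, 34767362, 43155968, 33562639, 8223, 35659790, 2367502, 2368524, 2434052, 19211264, 
  24606, 16446, 4218908, 4735004, 4737048, 4868104, 38422528, 49212, 32892, 8437816, 9470008, 
  9474096, 9736208, 9744384, 98424, 65784, 16875632, 18940016, 18940001, 19464225, 19480577, 
  196848, 131568, 33751264, 37880032, 37880002, 38928450, 38961154, 393696, 263136, 401856, 
  8659392, 8659332, 10756228, 10821636, 787392, 526272, 803712, 17318784, 17318664, 21512456, 
  21643272, 1574784, 1052544, 1607424, 34637568, 34637328, 43024912, 43286544, 3149568, 
  2105088, 3214848, 2174464, 2173984, 18949152, 19472416, 6299136, 4201985, 6429696, 4348928, 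
  4347968, 37898304, 38944832]

def LN : List ℕ := [
  31, 62, 124, 248, 496, 992, 1984, 3968, 4111, 6151, 7171, 7681, 7936, 8215, 8219, 8221, 
  16430, 16438, 16442, 24590, 24598, 24602, 32860, 32876, 32884, 49180, 49196, 49204, 65720, 
  65752, 65768, 76832, 77312, 98360, 98392, 98408, 131440, 131504, 131536, 139712, 153664, 
  154624, 196720, 196784, 196816, 262880, 263008, 263072, 270350, 270724, 271372, 279424, 
  299137, 301057, 307328, 336900, 393440, 393568, 393632, 401600, 401728, 401792, 525760, 
  526016, 526144, 540700, 541448, 542744, 558848, 590083, 593923, 606465, 673800, 786880, 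
  787136, 787264, 803200, 803456, 803584, 1051520, 1052032, 1052288, 1081400, 1082896, 1085488, 
  1117696, 1179655, 1180166, 1212930, 1347600, 1355776, 1573760, 1574272, 1574528, 1606400, 
  1606912, 1607168, 2103040, 2104064, 2104576, 2106380, 2108448, 2108928, 2162785, 2162800, 
  2165792, 2171908, 2172416, 2172960, 2173440, 2235392, 2359310, 2360332, 2367494, 2367498, 
  2367620, 2368520, 2400384, 2425860, 2687009, 2695200, 2703361, 3147520, 3148544, 3149056, 
  3212800, 3213824, 3214336, 4197889, 4199937, 4200961, 4202524, 4212760, 4216896, 4217856, 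
  4218892, 4218900, 4218904, 4325570, 4325600, 4331584, 4343816, 4344832, 4345920, 4346880, 
  4462593, 4718620, 4720664, 4734988, 4734996, 4735240, 4737040, 4800768, 4851720, 5374018, 
  5390400, 5406722, 6295040, 6297088, 6298112, 6425600, 6427648, 6428672, 8391683, 8393731, 
  8395778, 8397188, 8397248, 8405048, 8425520, 8425601, 8427521, 8433792, 8437784, 8437800, 
  8437808, 8651140, 8651200, 8654977, 8659136, 8659204, 8659264, 8663168, 8683649, 8685569, 
  8687632, 8689664, 8724484, 8916995, 9437240, 9441328, 9469976, 9469992, 9470480, 9474080, 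
  9482240, 9601536, 9703440, 9711616, 9740288, 10494084, 10526848, 10559492, 10748036, 10780800, 
  10788864, 10813444, 10821632, 12585985, 12588033, 12590080, 12847105, 12849153, 12851200, 
  16779271, 16783365, 16783366, 16794376, 16794496, 16810096, 16842849, 16843011, 16846851, 
  16852000, 16859393, 16875568, 16875600, 16875616, 17114112, 17301763, 17302280, 17302400, 
  17318145, 17318272, 17318408, 17318528, 17367073, 17367298, 17371137, 17371138, 17375264, 
  17448968, 17825799, 18874465, 18874480, 18883616, 18939952, 18939969, 18939984, 18940960, 
  18956289, 19145728, 19203072, 19210240, 19398689, 19406880, 19415041, 19472384, 19480576, 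
  20988168, 21053696, 21118984, 21496072, 21561600, 21577728, 21626888, 21643264, 25167875, 
  25171969, 25171970, 25690115, 25694209, 25694210, 33558539, 33558541, 33558542, 33562631, 
  33562635, 33562637, 33588752, 33588992, 33620192, 33685511, 33685698, 33686022, 33704000, 
  33718786, 33751136, 33751200, 33751232, 34228224, 34603526, 34604560, 34604800, 34636290, 
  34636544, 34636816, 34637056, 34734083, 34734085, 34734146, 34734596, 34750528, 34897936, 
  35651598, 35659782, 35659786, 35659788, 37748930, 37748960, 37767232, 37879904, 37879938, 
  37879968, 37881920, 37912578, 38291456, 38406144, 38420480, 38797378, 38813760, 38830082, 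
  38944768, 38961152, 41976336, 42107392, 42237968, 42992144, 43123200, 43155456, 43253776, 
  43286528, 50335747, 50335749, 50335750, 51380227, 51380229, 51380230]

def ordA : List ℕ := [
  4201984, 18940000, 19464224, 19480576, 8222, 33562638, 34734086, 51380230, 33558542, 50335750, 
  17383680, 17367298, 17371138, 25694210, 16783366, 25171970, 8687744, 8689664, 12851200, 
  8395778, 12590080]

def ordB : List ℕ := [
  19464224, 2166272, 2165792, 18940960, 4210716, 16414, 19203072, 31, 33554447, 35651598, 
  2359310, 2360332, 2425860, 10813444, 393664, 8651200, 8651140, 10748036, 9736192, 10780800, 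
  8687744]

def baseM : List ℕ := [12590081, 8395779, 12851201, 8689665, 8687745, 8695936, 10788992]

/-! Bitmask encoding of vertex sets. -/

def idx (p : Fin 2 × ZMod 13) : ℕ := 13 * p.1.val + p.2.val

def dec (m : ℕ) : Finset (Fin 2 × ZMod 13) := Finset.univ.filter fun p => m.testBit (idx p) = true

def D (L : List ℕ) : Finset (Finset (Fin 2 × ZMod 13)) := (L.map dec).toFinset

def pc (m : ℕ) : ℕ := ((List.range 26).filter fun i => m.testBit i).length

def sub (m n : ℕ) : Bool := Nat.beq (Nat.land m n) m

def er (m : ℕ) : List ℕ := ((List.range 26).filter fun i => m.testBit i).map fun i => m ^^^ 2 ^ i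

def tb (m i : ℕ) : Bool := Nat.beq (Nat.land (Nat.shiftRight m i) 1) 1

def rfK {β : Type} (i : ℕ) (k : List ℕ → β) : List ℕ → List ℕ → β
  | [], acc => k acc
  | x :: xs, acc => bif tb x i then rfK i k xs (x :: acc) else rfK i k xs acc

def cnt : ℕ → ℕ → List ℕ → ℕ
  | _, 0, L => bif L.isEmpty then 0 else 1
  | 0, _ + 1, _ => 0
  | i + 1, k + 1, L => bif L.isEmpty then 0 else
      Nat.add (cnt i (k + 1) L) (rfK i (cnt i k) L [])

def two : ℕ → ℕ → List ℕ → Bool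
  | _, 0, L => Nat.ble L.length 2
  | 0, _ + 1, _ => true
  | i + 1, k + 1, L => L.isEmpty || (two i (k + 1) L && rfK i (two i k) L [])

def rot13 (j x : ℕ) : ℕ := (x * 2 ^ j) % 8192 + x * 2 ^ j / 8192

def rot (j m : ℕ) : ℕ := rot13 j (m % 8192) + 8192 * rot13 j (m / 8192)

def joinT (s : ℕ) (L : List ℕ) : ℕ := L.foldr (fun q t => (q &&& s) ||| t) 0

def chk : List ℕ → Bool
  | [] => false
  | [s] => Nat.beq (pc s) 5
  | s :: (r :: rs) => chk (r :: rs) && (Nat.beq (pc s) 5 &&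
      (Nat.beq (pc (joinT s (r :: rs))) 4 && (Nat.ble (joinT s (r :: rs)) 67108863 &&
        Nat.beq (((r :: rs).filter (sub (joinT s (r :: rs)))).length) 1)))

lemma idx_lt (p : Fin 2 × ZMod 13) : idx p < 26 := by
  revert p; decide +kernel

lemma idx_inj : Function.Injective idx := by
  have h : ∀ p q : Fin 2 × ZMod 13, idx p = idx q → p = q := by decide +kernel
  intro p q; exact h p q

lemma idx_surj (i : ℕ) (hi : i < 26) : ∃ p, idx p = i := by
  have h : ∀ i ∈ List.range 26, ∃ p, idx p = i := by decide +kernel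
  exact h i (List.mem_range.2 hi)

@[simp] lemma mem_dec {m : ℕ} {p} : p ∈ dec m ↔ m.testBit (idx p) = true := by simp [dec]

lemma mem_D {L : List ℕ} {s} : s ∈ D L ↔ ∃ m ∈ L, dec m = s := by simp [D]

lemma high {m : ℕ} (hm : m < 2 ^ 26) {i : ℕ} (hi : 26 ≤ i) : m.testBit i = false :=
  Nat.testBit_lt_two_pow (lt_of_lt_of_le hm (Nat.pow_le_pow_right (by norm_num) hi))

lemma sub_iff {m n : ℕ} (hm : m < 2 ^ 26) : sub m n = true ↔ dec m ⊆ dec n := by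
  unfold sub
  rw [Nat.beq_eq]
  change m &&& n = m ↔ _
  constructor
  · intro h p hp
    rw [mem_dec] at *
    rw [← h, Nat.testBit_and] at hp
    simp at hp
    exact hp.2
  · intro h
    apply Nat.eq_of_testBit_eq
    intro i
    rw [Nat.testBit_and]
    by_cases hi : i < 26
    · obtain ⟨p, rfl⟩ := idx_surj i hi
      have := @h p
      rw [mem_dec, mem_dec] at this
      cases h1 : m.testBit (idx p) <;> simp_all
    · rw [high hm (not_lt.1 hi)]; rfl

lemma dec_inj {m n : ℕ} (hm : m < 2 ^ 26) (hn : n < 2 ^ 26) (h : dec m = dec n) : m = n := by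
  apply Nat.eq_of_testBit_eq
  intro i
  by_cases hi : i < 26
  · obtain ⟨p, rfl⟩ := idx_surj i hi
    have : p ∈ dec m ↔ p ∈ dec n := by rw [h]
    rw [mem_dec, mem_dec] at this
    exact Bool.eq_iff_iff.2 this
  · rw [high hm (not_lt.1 hi), high hn (not_lt.1 hi)]

lemma card_dec (m : ℕ) : (dec m).card = pc m := by
  unfold pc
  rw [← List.toFinset_card_of_nodup (List.nodup_range.filter _),
    ← Finset.card_image_of_injective (dec m) idx_inj]
  congr 1
  ext i
  simp only [Finset.mem_image, mem_dec, List.mem_toFinset, List.mem_filter, List.mem_range]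
  constructor
  · rintro ⟨p, hp, rfl⟩; exact ⟨idx_lt p, hp⟩
  · rintro ⟨h1, h2⟩
    obtain ⟨p, rfl⟩ := idx_surj i h1
    exact ⟨p, h2, rfl⟩

lemma dec_xor {m : ℕ} {p} (hp : p ∈ dec m) : dec (m ^^^ 2 ^ idx p) = (dec m).erase p := by
  ext q
  rw [mem_dec] at hp
  rw [Finset.mem_erase, mem_dec, mem_dec, Nat.testBit_xor, Nat.testBit_two_pow]
  by_cases h : q = p
  · subst h; simp [hp]
  · have : idx p ≠ idx q := fun h' => h (idx_inj h').symm
    simp [this, h]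

lemma mem_er {m n : ℕ} : n ∈ er m ↔ ∃ p ∈ dec m, n = m ^^^ 2 ^ idx p := by
  simp only [er, List.mem_map, List.mem_filter, List.mem_range, mem_dec]
  constructor
  · rintro ⟨i, ⟨h1, h2⟩, rfl⟩
    obtain ⟨p, rfl⟩ := idx_surj i h1
    exact ⟨p, h2, rfl⟩
  · rintro ⟨p, hp, rfl⟩
    exact ⟨idx p, ⟨idx_lt p, hp⟩, rfl⟩

lemma er_lt {m n : ℕ} (hm : m < 2 ^ 26) (h : n ∈ er m) : n < 2 ^ 26 := by
  obtain ⟨p, hp, rfl⟩ := mem_er.1 h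
  exact Nat.xor_lt_two_pow hm (Nat.pow_lt_pow_right (by norm_num) (idx_lt p))

lemma er_card {m n k : ℕ} (hm : (dec m).card = k + 1) (h : n ∈ er m) : (dec n).card = k := by
  obtain ⟨p, hp, rfl⟩ := mem_er.1 h
  rw [dec_xor hp, Finset.card_erase_of_mem hp, hm]; rfl

lemma er_sub {m n : ℕ} (h : n ∈ er m) : dec n ⊆ dec m := by
  obtain ⟨p, hp, rfl⟩ := mem_er.1 h
  rw [dec_xor hp]; exact Finset.erase_subset _ _

lemma sub_er {m k : ℕ} {s} (hm : (dec m).card = k + 1) (hs : s ⊆ dec m) (hk : s.card = k) :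
    ∃ n ∈ er m, dec n = s := by
  have h1 : (dec m \ s).card = 1 := by
    rw [Finset.card_sdiff_of_subset hs]; omega
  obtain ⟨p, hp⟩ := Finset.card_eq_one.1 h1
  have hpm : p ∈ dec m \ s := by rw [hp]; simp
  have hpd := (Finset.mem_sdiff.1 hpm).1
  refine ⟨_, mem_er.2 ⟨p, hpd, rfl⟩, ?_⟩
  rw [dec_xor hpd, ← Finset.sdiff_singleton_eq_erase, ← hp, Finset.sdiff_sdiff_eq_self hs]

lemma filter_card {L : List ℕ} (hL : ∀ m ∈ L, m < 2 ^ 26) (hnd : L.Nodup) {n : ℕ}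
    (hn : n < 2 ^ 26) :
    ((D L).filter fun σ => dec n ⊆ σ).card = (L.filter (sub n)).length := by
  rw [← List.toFinset_card_of_nodup (hnd.filter _)]
  symm
  rw [← Finset.card_image_of_injOn (f := dec)]
  · congr 1
    ext s
    simp only [Finset.mem_image, List.mem_toFinset, List.mem_filter, Finset.mem_filter, mem_D]
    constructor
    · rintro ⟨m, ⟨h1, h2⟩, rfl⟩
      exact ⟨⟨m, h1, rfl⟩, (sub_iff hn).1 h2⟩
    · rintro ⟨⟨m, h1, rfl⟩, h2⟩
      exact ⟨m, ⟨h1, (sub_iff hn).2 h2⟩, rfl⟩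
  · intro x hx y hy h
    simp at hx hy
    exact dec_inj (hL x hx.1) (hL y hy.1) h

lemma tb_eq (m i : ℕ) : tb m i = m.testBit i := by
  rw [Bool.eq_iff_iff, tb, Nat.beq_eq, Nat.testBit_eq_decide_div_mod_eq]
  change (m >>> i) &&& 1 = 1 ↔ _
  rw [Nat.and_one_is_mod, Nat.shiftRight_eq_div_pow]
  simp

lemma rfK_eq {β : Type} (i : ℕ) (k : List ℕ → β) (L acc : List ℕ) :
    rfK i k L acc = k ((L.filter fun m => m.testBit i).reverse ++ acc) := by
  induction L generalizing acc with
  | nil => simp [rfK]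
  | cons x L ih =>
    rw [rfK, tb_eq]
    cases h : x.testBit i <;> simp [ih, h]

lemma cnt_eq (i k : ℕ) (L : List ℕ) :
    cnt i k L = ((Finset.powersetCard k (Finset.range i)).filter
      fun s => ∃ m ∈ L, ∀ j ∈ s, m.testBit j = true).card := by
  classical
  induction i generalizing k L with
  | zero =>
    cases k with
    | zero => cases L <;> simp [cnt, Finset.filter_singleton]
    | succ k =>
      rw [cnt, Finset.range_zero, Finset.powersetCard_eq_empty.2 (by simp)]; rfl
  | succ i ih =>
    cases k with
    | zero => cases L <;> simp [cnt, Finset.filter_singleton]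
    | succ k =>
      cases hL : L.isEmpty with
      | true =>
        rw [List.isEmpty_iff] at hL; subst hL; simp [cnt]
      | false =>
        rw [cnt, hL, cond_false, rfK_eq, ih, ih, Finset.range_add_one,
          Finset.powersetCard_succ_insert Finset.notMem_range_self, Finset.filter_union,
          Finset.card_union_of_disjoint]
        · rw [Nat.add_eq]
          congr 1
          rw [← Finset.card_image_of_injOn (f := insert i)]
          · congr 1
            ext s
            simp only [Finset.mem_image, Finset.mem_filter, List.append_nil, List.mem_reverse,
              List.mem_filter]
            constructor
            · rintro ⟨t, ⟨h1, m, ⟨h2, h3⟩, h4⟩, rfl⟩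
              refine ⟨⟨t, h1, rfl⟩, m, h2, ?_⟩
              intro j hj
              rcases Finset.mem_insert.1 hj with rfl | hj
              · exact h3
              · exact h4 j hj
            · rintro ⟨⟨t, h1, rfl⟩, m, h2, h3⟩
              exact ⟨t, ⟨h1, m, ⟨h2, h3 i (Finset.mem_insert_self _ _)⟩,
                fun j hj => h3 j (Finset.mem_insert_of_mem hj)⟩, rfl⟩
          · intro s hs t ht h
            have hs' : i ∉ s := fun hi => by
              simp [Finset.mem_powersetCard] at hs
              simpa using hs.1.1 hi
            have ht' : i ∉ t := fun hi => by
              simp [Finset.mem_powersetCard] at ht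
              simpa using ht.1.1 hi
            have h' : insert i s = insert i t := h
            rw [← Finset.erase_insert hs', h', Finset.erase_insert ht']
        · rw [Finset.disjoint_left]
          intro s hs ht
          simp only [Finset.mem_filter, Finset.mem_image, Finset.mem_powersetCard] at hs ht
          obtain ⟨⟨t, _, rfl⟩, _⟩ := ht
          have := hs.1.1 (Finset.mem_insert_self i t)
          simp at this

lemma two_sound (i k : ℕ) (L : List ℕ) (h : two i k L = true) (s : Finset ℕ)
    (hs : s ⊆ Finset.range i) (hk : s.card = k) :
    (L.filter fun m => decide (∀ j ∈ s, m.testBit j = true)).length ≤ 2 := by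
  induction i generalizing k L s with
  | zero =>
    cases k with
    | zero =>
      rw [two] at h
      exact (List.length_filter_le _ _).trans (Nat.le_of_ble_eq_true h)
    | succ k =>
      have : s = ∅ := by simpa using hs
      subst this; simp at hk
  | succ i ih =>
    cases k with
    | zero =>
      rw [two] at h
      exact (List.length_filter_le _ _).trans (Nat.le_of_ble_eq_true h)
    | succ k =>
      rw [two, Bool.or_eq_true, Bool.and_eq_true, rfK_eq] at h
      rcases h with h | ⟨h1, h2⟩
      · rw [List.isEmpty_iff] at h; subst h; simp
      · by_cases hi : i ∈ s
        · have := ih k _ h2 (s.erase i) (by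
            intro j hj
            have h3 := Finset.mem_erase.1 hj
            have h4 := hs h3.2
            rw [Finset.mem_range] at *
            omega) (by rw [Finset.card_erase_of_mem hi, hk]; rfl)
          rw [List.append_nil, List.filter_reverse, List.length_reverse, List.filter_filter] at this
          convert this using 3
          ext m
          rw [Bool.eq_iff_iff, Bool.and_eq_true, decide_eq_true_iff, decide_eq_true_iff]
          constructor
          · intro h
            exact ⟨fun j hj => h j (Finset.mem_of_mem_erase hj), h i hi⟩
          · rintro ⟨h, h'⟩ j hj
            by_cases hji : j = i
            · rw [hji]; exact h'
            · exact h j (Finset.mem_erase.2 ⟨hji, hj⟩)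
        · refine ih (k + 1) L h1 s ?_ hk
          intro j hj
          have h4 := hs hj
          have : j ≠ i := fun h => hi (h ▸ hj)
          rw [Finset.mem_range] at *
          omega

lemma sub_dec {s : Finset (Fin 2 × ZMod 13)} {m : ℕ} :
    s ⊆ dec m ↔ ∀ j ∈ s.image idx, m.testBit j = true := by
  simp only [Finset.mem_image, forall_exists_index, and_imp, forall_apply_eq_imp_iff₂]
  constructor
  · intro h p hp; exact mem_dec.1 (h hp)
  · intro h p hp; exact mem_dec.2 (h p hp)

lemma fc_eq (L : List ℕ) (k : ℕ) : faceCount (D L) k = cnt 26 k L := by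
  rw [cnt_eq, faceCount, ← Finset.card_image_of_injective _ (Finset.image_injective idx_inj)]
  congr 1
  ext t
  simp only [Finset.mem_image, Finset.mem_biUnion, mem_D, Finset.mem_powersetCard,
    Finset.mem_filter]
  constructor
  · rintro ⟨s, ⟨_, ⟨m, hm, rfl⟩, h1, h2⟩, rfl⟩
    refine ⟨⟨?_, by rw [Finset.card_image_of_injective _ idx_inj, h2]⟩, m, hm, sub_dec.1 h1⟩
    intro j hj
    obtain ⟨p, _, rfl⟩ := Finset.mem_image.1 hj
    exact Finset.mem_range.2 (idx_lt p)
  · rintro ⟨⟨h1, h2⟩, m, hm, h3⟩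
    have ht : (Finset.univ.filter fun p => idx p ∈ t).image idx = t := by
      ext j
      simp only [Finset.mem_image, Finset.mem_filter, Finset.mem_univ, true_and]
      constructor
      · rintro ⟨p, hp, rfl⟩; exact hp
      · intro hj
        obtain ⟨p, rfl⟩ := idx_surj j (Finset.mem_range.1 (h1 hj))
        exact ⟨p, hj, rfl⟩
    refine ⟨Finset.univ.filter fun p => idx p ∈ t, ⟨_, ⟨m, hm, rfl⟩, ?_, ?_⟩, ht⟩
    · rw [sub_dec, ht]; exact h3
    · rw [← Finset.card_image_of_injective _ idx_inj, ht, h2]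

lemma two_D (L : List ℕ) (k : ℕ) (h : two 26 k L = true) (s : Finset (Fin 2 × ZMod 13))
    (hs : s.card = k) : ((D L).filter fun τ => s ⊆ τ).card ≤ 2 := by
  have h1 := two_sound 26 k L h (s.image idx) (by
    intro j hj
    obtain ⟨p, _, rfl⟩ := Finset.mem_image.1 hj
    exact Finset.mem_range.2 (idx_lt p)) (by rw [Finset.card_image_of_injective _ idx_inj, hs])
  refine le_trans ?_ h1
  refine le_trans (Finset.card_le_card ?_) (((List.toFinset_card_le
    ((L.filter fun m => decide (∀ j ∈ s.image idx, m.testBit j = true)).map dec))).trans_eq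
      (List.length_map _))
  intro τ hτ
  rw [Finset.mem_filter, mem_D] at hτ
  obtain ⟨⟨m, hm, rfl⟩, h⟩ := hτ
  rw [List.mem_toFinset]
  exact List.mem_map.2 ⟨m, List.mem_filter.2 ⟨hm, decide_eq_true (sub_dec.1 h)⟩, rfl⟩

lemma joinT_mem (s : ℕ) (L : List ℕ) (i : ℕ) :
    (joinT s L).testBit i = true ↔ ∃ q ∈ L, q.testBit i = true ∧ s.testBit i = true := by
  induction L with
  | nil => simp [joinT]
  | cons x L ih =>
    have : joinT s (x :: L) = (x &&& s) ||| joinT s L := rfl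
    rw [this, Nat.testBit_or, Nat.testBit_and]
    simp [ih]

lemma chk_sound (L : List ℕ) (h : chk L = true) : IsStackedBall 4 (D L) := by
  induction L with
  | nil => simp [chk] at h
  | cons s r ih =>
    cases r with
    | nil =>
      have : D [s] = {dec s} := by simp [D]
      rw [this]
      apply IsStackedBall.single
      rw [card_dec]
      exact Nat.eq_of_beq_eq_true h
    | cons r rs =>
      simp only [chk, Bool.and_eq_true, Nat.beq_eq] at h
      obtain ⟨h1, h2, h3, h4, h5⟩ := h
      generalize r :: rs = L at *
      have ht : joinT s L < 2 ^ 26 := by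
        have := Nat.le_of_ble_eq_true h4
        norm_num; omega
      have hD : D (s :: L) = insert (dec s) (D L) := by simp [D]
      rw [hD]
      have hint : ∀ ρ ∈ D L, ρ ∩ dec s ⊆ dec (joinT s L) := by
        intro ρ hρ
        obtain ⟨q, hq, rfl⟩ := mem_D.1 hρ
        intro p hp
        rw [Finset.mem_inter, mem_dec, mem_dec] at hp
        rw [mem_dec, joinT_mem]
        exact ⟨q, hq, hp⟩
      refine IsStackedBall.glue 4 (D L) (dec s) (dec (joinT s L)) (ih h1) ?_ ?_ ?_ ?_ ?_ hint
      · rw [card_dec, h2]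
      · intro hs
        have := Finset.card_le_card (hint _ hs)
        rw [Finset.inter_self, card_dec, card_dec, h2, h3] at this
        omega
      · intro p hp
        rw [mem_dec, joinT_mem] at hp
        obtain ⟨q, _, _, h⟩ := hp
        exact mem_dec.2 h
      · rw [card_dec, h3]
      · obtain ⟨q, hq⟩ := List.length_eq_one_iff.1 h5
        have hq' : ∀ x, x ∈ L ∧ sub (joinT s L) x = true ↔ x = q := by
          intro x
          rw [← List.mem_filter, hq, List.mem_singleton]
        refine ⟨dec q, ⟨mem_D.2 ⟨q, ((hq' q).2 rfl).1, rfl⟩, (sub_iff ht).1 ((hq' q).2 rfl).2⟩, ?_⟩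
        rintro _ ⟨hy, hy2⟩
        obtain ⟨x, hx, rfl⟩ := mem_D.1 hy
        rw [(hq' x).1 ⟨hx, (sub_iff ht).2 hy2⟩]

/-- Links commute with boundaries. -/
lemma link_bdry {W : Type*} [DecidableEq W] (d : ℕ) (F : Finset (Finset W)) (x : W) :
    linkFacets (bdryFacets (d + 1) F) x = bdryFacets d (linkFacets F x) := by
  have key : ∀ τ : Finset W, x ∉ τ →
      ((linkFacets F x).filter fun σ => τ ⊆ σ).card =
        (F.filter fun σ => insert x τ ⊆ σ).card := by
    intro τ hx
    symm
    rw [← Finset.card_image_of_injOn (f := fun σ : Finset W => σ.erase x)]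
    · congr 1
      ext s
      simp only [linkFacets, Finset.mem_image, Finset.mem_filter]
      constructor
      · rintro ⟨σ, ⟨h1, h2⟩, rfl⟩
        rw [Finset.insert_subset_iff] at h2
        exact ⟨⟨σ, ⟨h1, h2.1⟩, rfl⟩, Finset.subset_erase.2 ⟨h2.2, hx⟩⟩
      · rintro ⟨⟨σ, ⟨h1, h2⟩, rfl⟩, h3⟩
        exact ⟨σ, ⟨h1, Finset.insert_subset h2 (Finset.subset_erase.1 h3).1⟩, rfl⟩
    · intro s hs t ht h
      simp [Finset.insert_subset_iff] at hs ht
      have h' : s.erase x = t.erase x := h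
      rw [← Finset.insert_erase hs.2.1, h', Finset.insert_erase ht.2.1]
  have nm : ∀ σ ∈ linkFacets F x, x ∉ σ := by
    intro σ hσ
    simp only [linkFacets, Finset.mem_image] at hσ
    obtain ⟨_, _, rfl⟩ := hσ
    simp
  ext s
  constructor
  · intro h
    unfold linkFacets at h
    simp only [Finset.mem_image, Finset.mem_filter] at h
    obtain ⟨τ, ⟨h1, hx⟩, rfl⟩ := h
    simp only [bdryFacets, Finset.mem_filter, Finset.mem_biUnion, Finset.mem_powersetCard] at h1 ⊢
    obtain ⟨⟨σ, hσ, h2, h3⟩, h4⟩ := h1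
    refine ⟨⟨σ.erase x, ?_, Finset.erase_subset_erase _ h2, ?_⟩, ?_⟩
    · exact Finset.mem_image.2 ⟨σ, Finset.mem_filter.2 ⟨hσ, h2 hx⟩, rfl⟩
    · rw [Finset.card_erase_of_mem hx, h3]; rfl
    · rw [key _ (Finset.notMem_erase _ _), Finset.insert_erase hx]; exact h4
  · intro h
    simp only [bdryFacets, Finset.mem_filter, Finset.mem_biUnion, Finset.mem_powersetCard] at h
    obtain ⟨⟨σ, hσ, h2, h3⟩, h4⟩ := h
    have hx : x ∉ s := fun h => nm σ hσ (h2 h)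
    rw [key _ hx] at h4
    simp only [linkFacets, Finset.mem_image, Finset.mem_filter] at hσ
    obtain ⟨ρ, ⟨h5, h6⟩, rfl⟩ := hσ
    refine Finset.mem_image.2 ⟨insert x s, Finset.mem_filter.2 ⟨?_, Finset.mem_insert_self _ _⟩,
      Finset.erase_insert hx⟩
    refine Finset.mem_filter.2 ⟨Finset.mem_biUnion.2 ⟨ρ, h5, Finset.mem_powersetCard.2 ⟨?_, ?_⟩⟩, h4⟩
    · exact Finset.insert_subset h6 (h2.trans (Finset.erase_subset _ _))
    · rw [Finset.card_insert_of_notMem hx, h3]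

/-! The finite computations. -/

lemma LB_ok : (LB.all fun m => Nat.blt m 67108864 && Nat.beq (pc m) 6) = true := by decide +kernel

lemma LN_ok : (LN.all fun m => Nat.blt m 67108864 && (Nat.beq (pc m) 5 &&
    Nat.beq (LB.filter (sub m)).length 1)) = true := by decide +kernel

lemma LB_nodup : LB.Nodup := by decide +kernel

lemma LN_sorted : LN.IsChain (· < ·) := by decide +kernel

lemma LB_LN : (LB.all fun m => (er m).all fun n =>
    !(Nat.beq (LB.filter (sub n)).length 1) || LN.any (Nat.beq n)) = true := by decide +kernel

lemma LN_pairs : ((List.range 26).all fun i => (List.range 26).all fun j =>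
    LN.any fun m => m.testBit i && m.testBit j) = true := by decide +kernel

lemma two4 : two 26 4 LN = true := by decide +kernel

lemma count5 : LN.length = 338 := by decide +kernel

lemma count4 : cnt 26 4 LN = 845 := by decide +kernel

lemma count3 : cnt 26 3 LN = 780 := by decide +kernel

lemma base_eq : baseB26 = D baseM := by decide +kernel

lemma base_rot : ∀ j : ZMod 13, ∀ m ∈ baseM, ∀ p : Fin 2 × ZMod 13,
    (rot j.val m).testBit (idx (p.1, p.2 + j)) = m.testBit (idx p) := by decide +kernel

lemma rot_LB : ∀ j : ZMod 13, ∀ m ∈ baseM, rot j.val m ∈ LB := by decide +kernel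

lemma LB_rot : ∀ n ∈ LB, ∃ j : ZMod 13, ∃ m ∈ baseM, rot j.val m = n := by decide +kernel

def ord (p : Fin 2 × ZMod 13) : List ℕ :=
  (if p.1 = 0 then ordA else ordB).map (rot p.2.val)

def lnk (p : Fin 2 × ZMod 13) : List ℕ :=
  (LB.filter fun m => m.testBit (idx p)).map fun m => m ^^^ 2 ^ idx p

lemma ord_ok : ∀ p, chk (ord p) = true := by decide +kernel

lemma ord_lnk : ∀ p, (∀ m ∈ ord p, m ∈ lnk p) ∧ (∀ m ∈ lnk p, m ∈ ord p) := by decide +kernel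

attribute [irreducible] LB LN baseM

lemma B26_eq : B26 = D LB := by
  have hs : ∀ j : ZMod 13, ∀ m ∈ baseM, shift13 j (dec m) = dec (rot j.val m) := by
    intro j m hm
    ext q
    simp only [shift13, Finset.mem_image]
    constructor
    · rintro ⟨p, hp, rfl⟩
      rw [mem_dec] at *
      rw [base_rot j m hm p, hp]
    · intro hq
      refine ⟨(q.1, q.2 - j), ?_, by ext <;> simp⟩
      rw [mem_dec] at *
      rw [← base_rot j m hm]
      simpa using hq
  ext s
  simp only [B26, Finset.mem_biUnion, Finset.mem_image, Finset.mem_univ, true_and, base_eq, mem_D]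
  constructor
  · rintro ⟨j, _, ⟨m, hm, rfl⟩, rfl⟩
    exact ⟨_, rot_LB j m hm, (hs j m hm).symm⟩
  · rintro ⟨n, hn, rfl⟩
    obtain ⟨j, m, hm, rfl⟩ := LB_rot n hn
    exact ⟨j, _, ⟨m, hm, rfl⟩, hs j m hm⟩

lemma LB_lt : ∀ m ∈ LB, m < 2 ^ 26 := by
  intro m hm
  have h := List.all_eq_true.1 LB_ok m hm
  simp [Nat.blt_eq] at h
  exact h.1

lemma LB_card : ∀ m ∈ LB, (dec m).card = 5 + 1 := by
  intro m hm
  have h := List.all_eq_true.1 LB_ok m hm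
  simp [Nat.blt_eq] at h
  rw [card_dec, h.2]

lemma LN_facts : ∀ m ∈ LN, m < 2 ^ 26 ∧ (dec m).card = 4 + 1 ∧ (LB.filter (sub m)).length = 1 := by
  intro m hm
  have h := List.all_eq_true.1 LN_ok m hm
  simp only [Bool.and_eq_true, Nat.blt_eq, Nat.beq_eq] at h
  rw [card_dec, h.2.1]
  exact ⟨h.1, rfl, h.2.2⟩

lemma LN_lt : ∀ m ∈ LN, m < 2 ^ 26 := fun m hm => (LN_facts m hm).1

lemma LN_card : ∀ m ∈ LN, (dec m).card = 4 + 1 := fun m hm => (LN_facts m hm).2.1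

lemma LN_nodup : LN.Nodup := by
  have := List.isChain_iff_pairwise.1 LN_sorted
  exact this.imp fun h => ne_of_lt h

lemma N26_eq : N26 = D LN := by
  ext s
  rw [N26, B26_eq, bdryFacets, Finset.mem_filter, mem_D]
  constructor
  · rintro ⟨h1, h2⟩
    simp only [Finset.mem_biUnion, mem_D, Finset.mem_powersetCard] at h1
    obtain ⟨_, ⟨m, hm, rfl⟩, h3, h4⟩ := h1
    obtain ⟨n, hn, rfl⟩ := sub_er (LB_card m hm) h3 h4
    rw [filter_card LB_lt LB_nodup (er_lt (LB_lt m hm) hn)] at h2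
    have h := List.all_eq_true.1 (List.all_eq_true.1 LB_LN m hm) n hn
    rw [h2, show Nat.beq 1 1 = true from rfl] at h
    simp only [Bool.not_true, Bool.false_or, List.any_eq_true, Nat.beq_eq] at h
    obtain ⟨x, hx, rfl⟩ := h
    exact ⟨_, hx, rfl⟩
  · rintro ⟨n, hn, rfl⟩
    obtain ⟨h1, h2, h3⟩ := LN_facts n hn
    rw [filter_card LB_lt LB_nodup h1]
    refine ⟨?_, h3⟩
    obtain ⟨q, hq⟩ := List.length_eq_one_iff.1 h3
    have hq' : q ∈ LB.filter (sub n) := by rw [hq]; simp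
    rw [List.mem_filter] at hq'
    exact Finset.mem_biUnion.2 ⟨dec q, mem_D.2 ⟨q, hq'.1, rfl⟩,
      Finset.mem_powersetCard.2 ⟨(sub_iff h1).1 hq'.2, h2⟩⟩

lemma N26_def : N26 = bdryFacets 5 B26 := rfl

attribute [local irreducible] N26 B26

lemma N_pairs (x y : Fin 2 × ZMod 13) : ∃ τ ∈ N26, x ∈ τ ∧ y ∈ τ := by
  have h := List.all_eq_true.1 (List.all_eq_true.1 LN_pairs (idx x) (List.mem_range.2 (idx_lt x)))
    (idx y) (List.mem_range.2 (idx_lt y))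
  rw [List.any_eq_true] at h
  obtain ⟨m, hm, h⟩ := h
  rw [Bool.and_eq_true] at h
  rw [N26_eq]
  exact ⟨dec m, mem_D.2 ⟨m, hm, rfl⟩, mem_dec.2 h.1, mem_dec.2 h.2⟩

lemma vs_univ : vertexSet N26 = Finset.univ := by
  ext x
  obtain ⟨τ, h1, h2, _⟩ := N_pairs x x
  simp only [vertexSet, Finset.mem_biUnion, Finset.mem_univ, iff_true]
  exact ⟨τ, h1, h2⟩

lemma cardV : (Finset.univ : Finset (Fin 2 × ZMod 13)).card = 26 := by decide +kernel

lemma N_card : ∀ τ ∈ N26, τ.card = 5 := by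
  intro τ h
  rw [N26_eq] at h
  obtain ⟨m, hm, rfl⟩ := mem_D.1 h
  exact LN_card m hm

lemma fc1 : faceCount N26 1 = 26 := by
  have : (N26.biUnion fun σ => σ.powersetCard 1) = Finset.univ.powersetCard 1 := by
    ext s
    simp only [Finset.mem_biUnion, Finset.mem_powersetCard, Finset.subset_univ, true_and]
    constructor
    · rintro ⟨_, _, _, h⟩; exact h
    · intro h
      obtain ⟨x, rfl⟩ := Finset.card_eq_one.1 h
      obtain ⟨τ, h1, h2, _⟩ := N_pairs x x
      exact ⟨τ, h1, by simpa using h2, h⟩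
  rw [faceCount, this, Finset.card_powersetCard, cardV]; rfl

lemma fc2 : faceCount N26 2 = 325 := by
  have : (N26.biUnion fun σ => σ.powersetCard 2) = Finset.univ.powersetCard 2 := by
    ext s
    simp only [Finset.mem_biUnion, Finset.mem_powersetCard, Finset.subset_univ, true_and]
    constructor
    · rintro ⟨_, _, _, h⟩; exact h
    · intro h
      obtain ⟨x, y, _, rfl⟩ := Finset.card_eq_two.1 h
      obtain ⟨τ, h1, h2, h3⟩ := N_pairs x y
      refine ⟨τ, h1, ?_, h⟩
      intro z hz
      simp only [Finset.mem_insert, Finset.mem_singleton] at hz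
      rcases hz with rfl | rfl
      · exact h2
      · exact h3
  rw [faceCount, this, Finset.card_powersetCard, cardV]; rfl

lemma fc5 : faceCount N26 5 = 338 := by
  have : (N26.biUnion fun σ => σ.powersetCard 5) = N26 := by
    ext s
    simp only [Finset.mem_biUnion, Finset.mem_powersetCard]
    constructor
    · rintro ⟨t, h1, h2, h3⟩
      rwa [Finset.eq_of_subset_of_card_le h2 (by rw [h3, N_card t h1])]
    · intro h
      exact ⟨s, h, subset_rfl, N_card s h⟩
  rw [faceCount, this, N26_eq, D, List.toFinset_card_of_nodup, List.length_map, count5]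
  exact LN_nodup.map_on fun x hx y hy h => dec_inj (LN_lt x hx) (LN_lt y hy) h

lemma fc4 : faceCount N26 4 = 845 := by
  rw [N26_eq, fc_eq, count4]

lemma fc3 : faceCount N26 3 = 780 := by
  rw [N26_eq, fc_eq, count3]

lemma N_links (x : Fin 2 × ZMod 13) : IsStackedSphere 3 (linkFacets N26 x) := by
  refine ⟨linkFacets B26 x, ?_, by rw [N26_def]; exact link_bdry 4 B26 x⟩
  have : linkFacets B26 x = D (ord x) := by
    ext s
    rw [B26_eq, mem_D]
    simp only [linkFacets, Finset.mem_image, Finset.mem_filter, mem_D]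
    have hl : ∀ n, n ∈ ord x ↔ n ∈ lnk x := fun n => ⟨(ord_lnk x).1 n, (ord_lnk x).2 n⟩
    constructor
    · rintro ⟨_, ⟨⟨m, hm, rfl⟩, hx⟩, rfl⟩
      refine ⟨m ^^^ 2 ^ idx x, (hl _).2 ?_, dec_xor hx⟩
      exact List.mem_map.2 ⟨m, List.mem_filter.2 ⟨hm, mem_dec.1 hx⟩, rfl⟩
    · rintro ⟨n, hn, rfl⟩
      obtain ⟨m, hm, rfl⟩ := List.mem_map.1 ((hl n).1 hn)
      rw [List.mem_filter] at hm
      have hx := mem_dec.2 hm.2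
      exact ⟨dec m, ⟨⟨m, hm.1, rfl⟩, hx⟩, (dec_xor hx).symm⟩
  rw [this]
  exact chk_sound _ (ord_ok x)

lemma N_two (s : Finset (Fin 2 × ZMod 13)) (hs : s.card = 4) :
    (N26.filter fun τ => s ⊆ τ).card ≤ 2 := by
  rw [N26_eq]
  exact two_D LN 4 two4 s hs

/-- The boundary complex is a 2-neighborly 4-dimensional weak
pseudomanifold on 26 vertices, every vertex link is a stacked 3-sphere (so it lies
in the Walkup class `K(4)`), its face vector is (26, 325, 780, 845, 338), and its
Euler characteristic is χ = (-26), so that `f₀ (f₀ - 11) = -15 χ`. -/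
theorem stmt17 :
    (∀ τ ∈ N26, τ.card = 5) ∧
      (∀ s : Finset (Fin 2 × ZMod 13), s.card = 4 → (N26.filter fun τ => s ⊆ τ).card ≤ 2) ∧
      (vertexSet N26).card = 26 ∧
      (∀ x ∈ vertexSet N26, ∀ y ∈ vertexSet N26, ∃ τ ∈ N26, x ∈ τ ∧ y ∈ τ) ∧
      (∀ x ∈ vertexSet N26, IsStackedSphere 3 (linkFacets N26 x)) ∧
      (faceCount N26 1 = 26 ∧ faceCount N26 2 = 325 ∧ faceCount N26 3 = 780 ∧
        faceCount N26 4 = 845 ∧ faceCount N26 5 = 338) ∧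
      ((faceCount N26 1 : ℤ) - faceCount N26 2 + faceCount N26 3 - faceCount N26 4 +
        faceCount N26 5 = (-26)) ∧
      ((faceCount N26 1 : ℤ) * ((faceCount N26 1 : ℤ) - 11) =
        -15 * ((faceCount N26 1 : ℤ) - faceCount N26 2 + faceCount N26 3 -
          faceCount N26 4 + faceCount N26 5)) := by
  refine ⟨N_card, N_two, by rw [vs_univ, cardV], fun x _ y _ => N_pairs x y,
    fun x _ => N_links x, ⟨fc1, fc2, fc3, fc4, fc5⟩, ?_, ?_⟩
  · rw [fc1, fc2, fc3, fc4, fc5]; norm_num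
  · rw [fc1, fc2, fc3, fc4, fc5]; norm_num
end
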